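/- Path augmentation along a shortest transfer path preserves non-redundancy: let π be a non-redundant allocation whose bundles partition G, let x, y ∈ L be distinct agents, and let T = (g_1, …, g_t) be a shortest path in the exchange graph G(π) from F_x(π) to π(y), i.e. g_1 ∈ F_x(π), g_t ∈ π(y), consecutive items are joined by arcs of G(π), and no such sequence has fewer items. Let π' be the allocation obtained from π by the path augmentation along T: item g_1 is reassigned to agent x, for each k ∈ {2, …, t} item g_k is reassigned to the agent owning g_{k−1} under π, and every item not in {g_1, …, g_t} keeps its owner. Then π' is non-redundant (u_z(π'(z)) = |π'(z)| for every z ∈ L), and moreover |π'(x)| = |π(x)| + 1, |π'(y)| = |π(y)| − 1, and |π'(z)| = |π(z)| for every agent z ∈ L \ {x, y}. -/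

import Mathlib

open scoped Classical

/-- A set function `u` on subsets of the finite ground set `I` (the set of items `G`)
is a *matroid rank function* (MRF). -/
def IsMRF {I : Type*} [DecidableEq I] (u : Finset I → ℕ) : Prop :=
  u ∅ = 0 ∧
  (∀ S T : Finset I, S ⊆ T → u S ≤ u T) ∧
  (∀ S T : Finset I, S ⊆ T → ∀ g ∉ T, u (T ∪ {g}) + u S ≤ u (S ∪ {g}) + u T) ∧
  ∀ (S : Finset I) (g : I), g ∉ S → u S ≤ u (S ∪ {g}) ∧ u (S ∪ {g}) ≤ u S + 1

/-- There is an arc from `g` to `g'` in the exchange graph `G(π)`: the owner `x` of `g`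
differs from the owner `y` of `g'`, and `x` is indifferent between `g` and `g'` given
its bundle, i.e. `u x ((π x \ {g}) ∪ {g'}) = u x (π x)`. -/
def ExchangeArc {I L : Type*} [DecidableEq I] (u : L → Finset I → ℕ)
    (π : L → Finset I) (g g' : I) : Prop :=
  ∃ x y : L, x ≠ y ∧ g ∈ π x ∧ g' ∈ π y ∧ u x ((π x \ {g}) ∪ {g'}) = u x (π x)

/-- `F_x(π)`: the set of items for which agent `x` has a strictly positive marginal
gain given its bundle `π x`. -/
def Fgain {I L : Type*} [DecidableEq I] (u : L → Finset I → ℕ)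
    (π : L → Finset I) (x : L) : Set I :=
  {g | u x (π x ∪ {g}) = u x (π x) + 1}

/-- A *transfer path* in the exchange graph `G(π)` from `F_x(π)` to `π(y)`:
a sequence of items `gs 0, …, gs (t-1)` (`t ≥ 1`) with `gs 0 ∈ F_x(π)`,
`gs (t-1) ∈ π y`, and consecutive items joined by arcs of `G(π)`. -/
def IsTransferPath {I L : Type*} [DecidableEq I] (u : L → Finset I → ℕ)
    (π : L → Finset I) (x y : L) (t : ℕ) (gs : ℕ → I) : Prop :=
  1 ≤ t ∧ gs 0 ∈ Fgain u π x ∧ gs (t - 1) ∈ π y ∧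
    ∀ k : ℕ, k + 1 < t → ExchangeArc u π (gs k) (gs (k + 1))

namespace IsMRF

variable {I : Type*} [DecidableEq I] {u : Finset I → ℕ}

theorem mono (hu : IsMRF u) {S T : Finset I} (h : S ⊆ T) : u S ≤ u T :=
  hu.2.1 S T h

theorem insert_le (hu : IsMRF u) (g : I) (S : Finset I) : u (insert g S) ≤ u S + 1 := by
  by_cases hg : g ∈ S
  · simp [hg]
  · have := (hu.2.2.2 S g hg).2
    rwa [Finset.union_singleton] at this

theorem insert_add_le (hu : IsMRF u) (g : I) {S T : Finset I} (h : S ⊆ T) :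
    u (insert g T) + u S ≤ u (insert g S) + u T := by
  by_cases hg : g ∈ T
  · rw [Finset.insert_eq_of_mem hg]
    have := hu.mono (Finset.subset_insert g S)
    omega
  · have := hu.2.2.1 S T h g hg
    rwa [Finset.union_singleton, Finset.union_singleton] at this

theorem union_le_add_card (hu : IsMRF u) (S T : Finset I) : u (S ∪ T) ≤ u S + T.card := by
  induction T using Finset.induction_on with
  | empty => simp
  | insert g T hg ih =>
    rw [Finset.union_insert, Finset.card_insert_of_notMem hg]
    have := hu.insert_le g (S ∪ T)
    omega

theorem le_card (hu : IsMRF u) (S : Finset I) : u S ≤ S.card := by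
  have := hu.union_le_add_card ∅ S
  rwa [Finset.empty_union, hu.1, zero_add] at this

/-- Subsets of independent sets are independent. -/
theorem eq_card_of_subset (hu : IsMRF u) {S T : Finset I} (h : S ⊆ T) (hT : u T = T.card) :
    u S = S.card := by
  have h1 := hu.union_le_add_card S (T \ S)
  rw [Finset.union_sdiff_of_subset h] at h1
  have h2 := Finset.card_sdiff_add_card_eq_card h
  have h3 := hu.le_card S
  omega

theorem insert_congr (hu : IsMRF u) (g : I) {S T : Finset I} (h : S ⊆ T) (heq : u S = u T) :
    u (insert g S) = u (insert g T) := by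
  have h1 := hu.insert_add_le g h
  have h2 := hu.mono (Finset.insert_subset_insert g h)
  omega

theorem union_eq_of_forall_insert_eq (hu : IsMRF u) {A T : Finset I}
    (h : ∀ g ∈ T, u (insert g A) = u A) : u (A ∪ T) = u A := by
  induction T using Finset.induction_on with
  | empty => simp
  | insert g T _ ih =>
    have ih' := ih fun g' hg' => h g' (Finset.mem_insert_of_mem hg')
    rw [Finset.union_insert, ← hu.insert_congr g Finset.subset_union_left ih'.symm]
    exact h g (Finset.mem_insert_self _ _)

/-- Simultaneous exchange in an independent set along a triangular system of exchange pairs. -/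
theorem exchange (hu : IsMRF u) (a b : ℕ → I) (K : Finset ℕ) (A : Finset I)
    (hA : u A = A.card) (ha : Set.InjOn a K) (hb : Set.InjOn b K)
    (haA : ∀ k ∈ K, a k ∈ A) (hbA : ∀ k ∈ K, b k ∉ A)
    (hdiag : ∀ k ∈ K, u (insert (b k) (A.erase (a k))) = A.card)
    (htri : ∀ i ∈ K, ∀ j ∈ K, i < j → u (insert (b j) (A.erase (a i))) < A.card) :
    u ((A \ K.image a) ∪ K.image b) = A.card ∧
      ((A \ K.image a) ∪ K.image b).card = A.card := by
  induction K using Finset.induction_on_max generalizing A with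
  | empty => simpa using hA
  | insert n K hn ih =>
    have hnK : n ∈ insert n K := Finset.mem_insert_self _ _
    have hsub : ∀ k ∈ K, k ∈ insert n K := fun k hk => Finset.mem_insert_of_mem hk
    have hane : ∀ k ∈ K, a k ≠ a n := fun k hk he =>
      (hn k hk).ne (ha (Finset.mem_coe.2 (hsub k hk)) (Finset.mem_coe.2 hnK) he)
    have hbne : ∀ k ∈ K, b k ≠ b n := fun k hk he =>
      (hn k hk).ne (hb (Finset.mem_coe.2 (hsub k hk)) (Finset.mem_coe.2 hnK) he)
    have hab : ∀ i ∈ insert n K, ∀ j ∈ insert n K, a i ≠ b j := fun i hi j hj he =>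
      hbA j hj (he ▸ haA i hi)
    set A' := insert (b n) (A.erase (a n)) with hA'
    have hpos : 0 < A.card := Finset.card_pos.2 ⟨_, haA n hnK⟩
    have hcard : A'.card = A.card := by
      rw [hA', Finset.card_insert_of_notMem fun h => hbA n hnK (Finset.mem_of_mem_erase h),
        Finset.card_erase_of_mem (haA n hnK)]
      omega
    have hA'u : u A' = A'.card := by rw [hcard]; exact hdiag n hnK
    have haA' : ∀ k ∈ K, a k ∈ A' := fun k hk =>
      Finset.mem_insert_of_mem (Finset.mem_erase.2 ⟨hane k hk, haA k (hsub k hk)⟩)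
    have hspan : ∀ i ∈ K, ∀ g, u (insert g (A'.erase (a i))) = u (insert g (A.erase (a i))) := by
      intro i hi g
      have h1 : A.erase (a i) ⊆ insert (b n) (A.erase (a i)) := Finset.subset_insert _ _
      have h2 : A'.erase (a i) ⊆ insert (b n) (A.erase (a i)) := by
        intro w hw
        simp only [hA', Finset.mem_erase, Finset.mem_insert] at hw ⊢
        tauto
      have h3 := hu.eq_card_of_subset (Finset.erase_subset (a i) A) hA
      have h4 := hu.eq_card_of_subset (Finset.erase_subset (a i) A') hA'u
      rw [Finset.card_erase_of_mem (haA i (hsub i hi))] at h3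
      rw [Finset.card_erase_of_mem (haA' i hi), hcard] at h4
      have h5 := htri i (hsub i hi) n hnK (hn i hi)
      have h6 := hu.mono h1
      rw [hu.insert_congr g h1 (by omega), hu.insert_congr g h2 (by omega)]
    have key := ih A' hA'u (ha.mono (by simp)) (hb.mono (by simp)) haA'
      (by
        intro k hk h
        rcases Finset.mem_insert.1 h with h | h
        · exact hbne k hk h
        · exact hbA k (hsub k hk) (Finset.mem_of_mem_erase h))
      (by
        intro k hk
        rw [hspan k hk, hcard]
        exact hdiag k (hsub k hk))
      (by
        intro i hi j hj hij
        rw [hspan i hi, hcard]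
        exact htri i (hsub i hi) j (hsub j hj) hij)
    have hset : (A \ (insert n K).image a) ∪ (insert n K).image b =
        (A' \ K.image a) ∪ K.image b := by
      have hbn : b n ∉ K.image a := by
        intro h
        obtain ⟨k, hk, he⟩ := Finset.mem_image.1 h
        exact hab k (hsub k hk) n hnK he
      ext w
      simp only [hA', Finset.image_insert, Finset.mem_union, Finset.mem_sdiff, Finset.mem_insert,
        Finset.mem_erase]
      by_cases hw : w = b n
      · subst hw
        simp [hbn]
      · tauto
    rw [hset, ← hcard]
    exact key

end IsMRF

namespace IsTransferPath

variable {I L : Type*} [DecidableEq I] {u : L → Finset I → ℕ} {π : L → Finset I} {x y : L}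
  {t : ℕ} {gs : ℕ → I}

theorem shortcut (h : IsTransferPath u π x y t gs) {i j : ℕ} (hij : i < j) (hj : j < t)
    (harc : ExchangeArc u π (gs i) (gs j)) :
    IsTransferPath u π x y (t - (j - (i + 1)))
      (fun k => if k ≤ i then gs k else gs (k + (j - (i + 1)))) := by
  obtain ⟨h1, h2, h3, h4⟩ := h
  refine ⟨by omega, by simpa using h2, ?_, ?_⟩
  · dsimp only
    rw [if_neg (by omega)]
    convert h3 using 2
    omega
  · intro k hk
    rcases lt_trichotomy k i with hki | rfl | hki
    · simpa [hki.le, Nat.succ_le_of_lt hki] using h4 k (by omega)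
    · have : k + 1 + (j - (k + 1)) = j := by omega
      simpa [this] using harc
    · have := h4 (k + (j - (i + 1))) (by omega)
      simp only [if_neg (show ¬ k ≤ i by omega), if_neg (show ¬ k + 1 ≤ i by omega)]
      convert this using 2
      omega

theorem take (h : IsTransferPath u π x y t gs) {i : ℕ} (hi : i < t) (hy : gs i ∈ π y) :
    IsTransferPath u π x y (i + 1) gs :=
  ⟨by omega, h.2.1, by simpa using hy, fun k hk => h.2.2.2 k (by omega)⟩

theorem drop (h : IsTransferPath u π x y t gs) {i : ℕ} (hi : i < t)
    (hx : gs i ∈ Fgain u π x) :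
    IsTransferPath u π x y (t - i) (fun k => gs (i + k)) := by
  refine ⟨by omega, by simpa using hx, ?_, fun k hk => h.2.2.2 (i + k) (by omega)⟩
  have : i + (t - i - 1) = t - 1 := by omega
  simpa only [this] using h.2.2.1

theorem not_exchangeArc (h : IsTransferPath u π x y t gs)
    (hshortest : ∀ (t' : ℕ) (gs' : ℕ → I), IsTransferPath u π x y t' gs' → t ≤ t')
    {i j : ℕ} (hij : i + 1 < j)
    (hj : j < t) : ¬ ExchangeArc u π (gs i) (gs j) := fun harc => by
  have := hshortest _ _ (h.shortcut (by omega) hj harc)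
  omega

theorem injOn (h : IsTransferPath u π x y t gs)
    (hshortest : ∀ (t' : ℕ) (gs' : ℕ → I), IsTransferPath u π x y t' gs' → t ≤ t') :
    Set.InjOn gs (Finset.range t) := by
  have key : ∀ i j, i < j → j < t → gs i ≠ gs j := by
    intro i j hij hj he
    by_cases hjt : j + 1 < t
    · exact h.not_exchangeArc hshortest (i := i) (j := j + 1) (by omega) hjt
        (he ▸ h.2.2.2 j hjt)
    · have hy := h.2.2.1
      rw [show t - 1 = j by omega, ← he] at hy
      have := hshortest _ _ (h.take (by omega) hy)
      omega
  intro i hi j hj he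
  simp only [Finset.coe_range, Set.mem_Iio] at hi hj
  rcases lt_trichotomy i j with hlt | rfl | hlt
  · exact (key i j hlt hj he).elim
  · rfl
  · exact (key j i hlt hi he.symm).elim

theorem notMem_Fgain (h : IsTransferPath u π x y t gs)
    (hshortest : ∀ (t' : ℕ) (gs' : ℕ → I), IsTransferPath u π x y t' gs' → t ≤ t')
    {j : ℕ} (hj0 : 0 < j) (hj : j < t) :
    gs j ∉ Fgain u π x := fun hx => by
  have := hshortest _ _ (h.drop hj hx)
  omega

end IsTransferPath

/-- path augmentation along a shortest transfer path preserves
non-redundancy.  Here `π` is an allocation whose bundles partition `G`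
(encoded by the owner function `own`: `i ∈ π z ↔ own i = z`), `π` is non-redundant,
`(gs 0, …, gs (t-1))` is a shortest path in the exchange graph `G(π)` from `F_x(π)`
to `π(y)`, and `π'` is obtained from `π` by the path augmentation along this path:
`gs 0` is reassigned to `x`, each `gs k` (for `1 ≤ k ≤ t-1`) is reassigned to the
owner of `gs (k-1)` under `π`, and every other item keeps its owner.  Then `π'` is
non-redundant, `|π'(x)| = |π(x)| + 1`, `|π'(y)| = |π(y)| − 1`, and `|π'(z)| = |π(z)|`
for every other agent `z`. -/
theorem path_augmentation_nonredundant {I L : Type*} [Fintype I] [DecidableEq I]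
    [Fintype L] [DecidableEq L] [Nonempty L]
    (u : L → Finset I → ℕ) (hu : ∀ z, IsMRF (u z))
    (π π' : L → Finset I) (own : I → L)
    (hown : ∀ (i : I) (z : L), i ∈ π z ↔ own i = z)
    (hπnr : ∀ z : L, u z (π z) = (π z).card)
    (x y : L) (hxy : x ≠ y)
    (t : ℕ) (gs : ℕ → I)
    (hpath : IsTransferPath u π x y t gs)
    (hshortest : ∀ (t' : ℕ) (gs' : ℕ → I), IsTransferPath u π x y t' gs' → t ≤ t')
    (hπ'def : ∀ z : L, π' z =
      (π z \ (Finset.range t).image gs) ∪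
      (((Finset.range t).filter fun k =>
          (if k = 0 then x else own (gs (k - 1))) = z).image gs)) :
    (∀ z : L, u z (π' z) = (π' z).card) ∧
    (π' x).card = (π x).card + 1 ∧
    (π' y).card + 1 = (π y).card ∧
    ∀ z : L, z ≠ x → z ≠ y → (π' z).card = (π z).card := by
  obtain ⟨s, rfl⟩ : ∃ s, t = s + 1 := ⟨t - 1, by have := hpath.1; omega⟩
  have hinj := hpath.injOn hshortest
  have hlast : own (gs s) = y := by simpa [hown] using hpath.2.2.1
  have harc : ∀ k < s, own (gs k) ≠ own (gs (k + 1)) ∧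
      u (own (gs k)) (insert (gs (k + 1)) ((π (own (gs k))).erase (gs k))) =
        u (own (gs k)) (π (own (gs k))) := by
    intro k hk
    obtain ⟨v, w, hvw, hv, hw, he⟩ := hpath.2.2.2 k (by omega)
    rw [hown] at hv hw
    subst hv hw
    rw [Finset.sdiff_singleton_eq_erase, Finset.union_singleton] at he
    exact ⟨hvw, he⟩
  have hcard : ∀ z, (π' z).card + (if y = z then 1 else 0) =
      (π z).card + (if x = z then 1 else 0) := by
    intro z
    set R := (Finset.range (s + 1)).filter fun k =>
      (if k = 0 then x else own (gs (k - 1))) = z with hR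
    set O := (Finset.range (s + 1)).filter fun k => own (gs k) = z with hO
    have hRc : R.card = (∑ k ∈ Finset.range s, if own (gs k) = z then 1 else 0) +
        if x = z then 1 else 0 := by
      rw [hR, Finset.card_filter, Finset.sum_range_succ']
      simp
    have hOc : O.card = (∑ k ∈ Finset.range s, if own (gs k) = z then 1 else 0) +
        if y = z then 1 else 0 := by
      rw [hO, Finset.card_filter, Finset.sum_range_succ, hlast]
    have h1 : (π' z).card = (π z \ (Finset.range (s + 1)).image gs).card + R.card := by
      rw [hπ'def z, Finset.card_union_of_disjoint, Finset.card_image_of_injOn]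
      · exact hinj.mono (Finset.coe_subset.2 (Finset.filter_subset _ _))
      · exact Finset.sdiff_disjoint.mono_right
          (Finset.image_subset_image (Finset.filter_subset _ _))
    have h2 : π z ∩ (Finset.range (s + 1)).image gs = O.image gs := by
      ext i
      simp only [hO, Finset.mem_inter, Finset.mem_image, Finset.mem_filter, hown]
      grind
    have h3 := Finset.card_sdiff_add_card_inter (π z) ((Finset.range (s + 1)).image gs)
    have h4 : (O.image gs).card = O.card := Finset.card_image_of_injOn
      (hinj.mono (Finset.coe_subset.2 (Finset.filter_subset _ _)))
    rw [h2] at h3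
    omega
  refine ⟨fun z => ?_, ?_, ?_, fun z hzx hzy => ?_⟩
  · set K := (Finset.range s).filter fun k => own (gs k) = z with hK
    have hKmem : ∀ k, k ∈ K ↔ k < s ∧ own (gs k) = z := by simp [hK]
    have hnot : ∀ k ∈ K, gs (k + 1) ∉ π z := by
      intro k hk hz
      obtain ⟨hks, rfl⟩ := (hKmem k).1 hk
      exact (harc k hks).1 ((hown _ _).1 hz).symm
    set B := (π z \ K.image gs) ∪ K.image fun k => gs (k + 1) with hB
    obtain ⟨hBu, hBc⟩ : u z B = (π z).card ∧ B.card = (π z).card := by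
      refine (hu z).exchange gs (fun k => gs (k + 1)) K (π z) (hπnr z) ?_ ?_ ?_ hnot ?_ ?_
      · refine hinj.mono fun k hk => ?_
        have := (hKmem k).1 hk
        simp
        omega
      · intro i hi j hj he
        have h1 := (hKmem i).1 hi
        have h2 := (hKmem j).1 hj
        have := hinj (by simp; omega) (by simp; omega) he
        omega
      · intro k hk
        exact (hown _ _).2 ((hKmem k).1 hk).2
      · intro k hk
        obtain ⟨hks, rfl⟩ := (hKmem k).1 hk
        rw [← hπnr]
        exact (harc k hks).2
      · intro i hi j hj hij
        obtain ⟨his, hiz⟩ := (hKmem i).1 hi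
        obtain ⟨hjs, -⟩ := (hKmem j).1 hj
        have hne : u z (insert (gs (j + 1)) ((π z).erase (gs i))) ≠ u z (π z) := by
          intro he
          refine hpath.not_exchangeArc hshortest (i := i) (j := j + 1) (by omega) (by omega)
            ⟨z, own (gs (j + 1)), fun h => hnot j hj ((hown _ _).2 h.symm), (hown _ _).2 hiz,
              (hown _ _).2 rfl, ?_⟩
          rw [Finset.sdiff_singleton_eq_erase, Finset.union_singleton]
          exact he
        have hle := (hu z).le_card (insert (gs (j + 1)) ((π z).erase (gs i)))
        have hc : (insert (gs (j + 1)) ((π z).erase (gs i))).card ≤ (π z).card := by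
          have h1 := Finset.card_insert_le (gs (j + 1)) ((π z).erase (gs i))
          rwa [Finset.card_erase_add_one ((hown _ _).2 hiz)] at h1
        have := hπnr z
        omega
    have hsub : ∀ i ∈ π' z, i ∈ B ∨ (x = z ∧ i = gs 0) := by
      intro i hi
      rw [hπ'def z, Finset.mem_union, Finset.mem_sdiff] at hi
      rcases hi with ⟨hi, hni⟩ | hi
      · left
        refine Finset.mem_union_left _ (Finset.mem_sdiff.2 ⟨hi, fun h => hni ?_⟩)
        obtain ⟨k, hk, rfl⟩ := Finset.mem_image.1 h
        have := (hKmem k).1 hk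
        exact Finset.mem_image_of_mem _ (by simp; omega)
      · obtain ⟨k, hk, rfl⟩ := Finset.mem_image.1 hi
        rw [Finset.mem_filter, Finset.mem_range] at hk
        rcases k with _ | k
        · exact Or.inr ⟨by simpa using hk.2, rfl⟩
        · left
          refine Finset.mem_union_right _ (Finset.mem_image.2 ⟨k, (hKmem k).2 ⟨by omega, ?_⟩, rfl⟩)
          simpa using hk.2
    by_cases hxz : x = z
    · subst hxz
      refine (hu x).eq_card_of_subset (T := insert (gs 0) B) (fun i hi => ?_) ?_
      · rw [Finset.mem_insert]
        have := hsub i hi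
        tauto
      · have hg : u x (insert (gs 0) (π x)) = u x (π x) + 1 := by
          simpa [Fgain] using hpath.2.1
        have hspan : u x (π x ∪ K.image fun k => gs (k + 1)) = u x (π x) := by
          refine (hu x).union_eq_of_forall_insert_eq fun g hgK => ?_
          obtain ⟨k, hk, rfl⟩ := Finset.mem_image.1 hgK
          have h1 := hpath.notMem_Fgain hshortest (j := k + 1) (by omega)
            (by have := (hKmem k).1 hk; omega)
          simp only [Fgain, Set.mem_ofPred_eq, Finset.union_singleton] at h1
          have h2 := (hu x).insert_le (gs (k + 1)) (π x)
          have h3 := (hu x).mono (Finset.subset_insert (gs (k + 1)) (π x))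
          omega
        have hBsub : B ⊆ π x ∪ K.image fun k => gs (k + 1) :=
          Finset.union_subset_union_left Finset.sdiff_subset
        have h1 := (hu x).insert_congr (gs 0) hBsub (by rw [hBu, hspan, hπnr])
        have h2 := (hu x).insert_congr (gs 0)
          (Finset.subset_union_left (s₁ := π x) (s₂ := K.image fun k => gs (k + 1))) hspan.symm
        have h3 := (hu x).le_card (insert (gs 0) B)
        have h4 := Finset.card_insert_le (gs 0) B
        have h5 := hπnr x
        omega
    · refine (hu z).eq_card_of_subset (T := B) (fun i hi => ?_) (hBu.trans hBc.symm)
      have := hsub i hi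
      tauto
  · simpa [hxy.symm] using hcard x
  · simpa [hxy] using hcard y
  · simpa [hzx.symm, hzy.symm] using hcard z
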